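/- arXiv:1603.06307 — 12 statements merged into one kernel-verified Lean document; each statement's English description precedes it below -/
import Mathlib

section
/- For every positive integer k, arctan(φ^(2k-1)) = 2·arctan(1) − (1/2)·arctan(2 / L_{2k-1}). -/
open Real Finset

/-- The Lucas numbers: `L 0 = 2`, `L 1 = 1`, `L (n+2) = L (n+1) + L n`. -/
def lucas : ℕ → ℕ
  | 0 => 2
  | 1 => 1
  | n + 2 => lucas (n + 1) + lucas n

/-- The golden ratio `φ = (1 + √5)/2`. -/
noncomputable def phi : ℝ := (1 + Real.sqrt 5) / 2

theorem phi_eq_goldenRatio : phi = goldenRatio := rfl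

/-- Binet's formula for the Lucas numbers. -/
theorem coe_lucas_eq (n : ℕ) : (lucas n : ℝ) = goldenRatio ^ n + goldenConj ^ n := by
  induction n using Nat.twoStepInduction with
  | zero => norm_num [lucas]
  | one => simp [lucas, goldenRatio_add_goldenConj]
  | more n ih₀ ih₁ =>
    rw [lucas, Nat.cast_add, ih₀, ih₁]
    linear_combination
      -goldenRatio ^ n * goldenRatio_sq - goldenConj ^ n * goldenConj_sq

theorem coe_lucas_of_odd {n : ℕ} (hn : Odd n) :
    (lucas n : ℝ) = goldenRatio ^ n - (goldenRatio ^ n)⁻¹ := by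
  rw [coe_lucas_eq, ← inv_pow, inv_goldenRatio, hn.neg_pow, sub_neg_eq_add]

theorem stmt0 (k : ℕ) (hk : 1 ≤ k) :
    Real.arctan (phi ^ (2 * k - 1)) =
      2 * Real.arctan 1 - (1 / 2) * Real.arctan (2 / (lucas (2 * k - 1) : ℝ)) := by
  have hodd : Odd (2 * k - 1) := ⟨k - 1, by omega⟩
  rw [coe_lucas_of_odd hodd, phi_eq_goldenRatio]
  have hx : 1 < goldenRatio ^ (2 * k - 1) := one_lt_pow₀ one_lt_goldenRatio (by omega)
  generalize goldenRatio ^ (2 * k - 1) = x at hx ⊢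
  have hpos : 0 < x ^ 2 - 1 := by nlinarith
  have harg : 2 * x / (1 - x ^ 2) = -(2 / (x - x⁻¹)) := by
    have hx₀ : x ≠ 0 := by positivity
    have hsub : x - x⁻¹ = (x ^ 2 - 1) / x := by field_simp
    rw [hsub, ← neg_sub (x ^ 2) 1, div_neg, div_div_eq_mul_div]
  have hdouble := two_mul_arctan_add_pi hx
  rw [harg, arctan_neg] at hdouble
  rw [arctan_one]
  linarith
end

section
/- For every positive integer k, arctan(φ^(2k+1)) = 2·arctan(1) + (1/2)·arctan(1 / L_{2k}) − (1/2)·arctan(1 / F_{2k}). -/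
open Real Finset

theorem lucas_add_fib (n : ℕ) : lucas n + Nat.fib n = 2 * Nat.fib (n + 1) := by
  induction n using Nat.twoStepInduction with
  | zero => simp [lucas]
  | one => simp [lucas]
  | more n ih₁ ih₂ =>
    have h₁ : Nat.fib (n + 2) = Nat.fib n + Nat.fib (n + 1) := Nat.fib_add_two
    have h₂ : Nat.fib (n + 2 + 1) = Nat.fib (n + 1) + Nat.fib (n + 2) := Nat.fib_add_two
    rw [show n + 1 + 1 = n + 2 from rfl] at ih₂
    simp only [lucas]
    omega

theorem phi_sq : phi ^ 2 = phi + 1 :=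
  Real.goldenRatio_sq

theorem phi_pow_succ (n : ℕ) :
    phi ^ (n + 1) = phi * Nat.fib (n + 1) + Nat.fib n :=
  (Real.goldenRatio_mul_fib_succ_add_fib n).symm

theorem fib_cassini_even (k : ℕ) :
    (Nat.fib (2 * k + 1) : ℝ) ^ 2 - Nat.fib (2 * k) * Nat.fib (2 * k + 1)
      - (Nat.fib (2 * k) : ℝ) ^ 2 = 1 := by
  induction k with
  | zero => simp
  | succ k ih =>
    rw [show 2 * (k + 1) = 2 * k + 2 by ring, Nat.fib_add_two (n := 2 * k + 1),
      Nat.fib_add_two (n := 2 * k)]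
    push_cast
    linear_combination ih

theorem arctan_inv_eq_add_of_cassini {a b : ℝ} (ha : 1 ≤ a) (hab : a < b)
    (h : b ^ 2 - a * b - a ^ 2 = 1) :
    arctan (1 / a) = arctan (1 / (2 * b - a)) + arctan (2 / (b + 2 * a)) := by
  have hL : 1 < 2 * b - a := by linarith
  have hL' : 3 < b + 2 * a := by linarith
  have hprod : 2 < (2 * b - a) * (b + 2 * a) := by nlinarith
  have hlt : 1 / (2 * b - a) * (2 / (b + 2 * a)) < 1 := by
    rw [div_mul_div_comm, div_lt_one (by positivity)]
    linarith
  rw [arctan_add hlt]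
  congr 1
  have hne : 1 - 1 / (2 * b - a) * (2 / (b + 2 * a)) ≠ 0 := by linarith
  rw [eq_div_iff hne]
  have hkey : (2 * b - a) * (b + 2 * a) - 2 = a * (b + 2 * a + 2 * (2 * b - a)) := by
    linear_combination 2 * h
  have h₁ : 2 * b - a ≠ 0 := by linarith
  have h₂ : b + 2 * a ≠ 0 := by linarith
  have h₃ : a ≠ 0 := by linarith
  generalize 2 * b - a = c at *
  generalize b + 2 * a = d at *
  field_simp
  linear_combination hkey

theorem two_mul_arctan_of_sq_eq {x c : ℝ} (hx : 1 < x) (h : x ^ 2 = 1 + c * x) :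
    2 * arctan x = π - arctan (2 / c) := by
  have hx₀ : x ≠ 0 := by linarith
  have hfrac : 2 * x / (1 - x ^ 2) = -(2 / c) := by
    rw [h, show 1 - (1 + c * x) = -(c * x) by ring, div_neg, mul_div_mul_right _ _ hx₀]
  rw [two_mul_arctan_add_pi hx, hfrac, arctan_neg]
  ring

theorem stmt1 (k : ℕ) (hk : 1 ≤ k) :
    Real.arctan (phi ^ (2 * k + 1)) =
      2 * Real.arctan 1 + (1 / 2) * Real.arctan (1 / (lucas (2 * k) : ℝ))
        - (1 / 2) * Real.arctan (1 / (Nat.fib (2 * k) : ℝ)) := by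
  have hL : (lucas (2 * k) : ℝ) = 2 * Nat.fib (2 * k + 1) - Nat.fib (2 * k) :=
    eq_sub_of_add_eq (mod_cast lucas_add_fib (2 * k))
  have ha : (1 : ℝ) ≤ Nat.fib (2 * k) := by
    exact_mod_cast Nat.fib_pos.mpr (by omega)
  have hcassini := fib_cassini_even k
  have hpow := phi_pow_succ (2 * k)
  have hx : 1 < phi ^ (2 * k + 1) :=
    one_lt_pow₀ Real.one_lt_goldenRatio (by omega)
  generalize phi ^ (2 * k + 1) = x at *
  have hb : (0 : ℝ) ≤ Nat.fib (2 * k + 1) := Nat.cast_nonneg _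
  generalize (Nat.fib (2 * k) : ℝ) = a at *
  generalize (Nat.fib (2 * k + 1) : ℝ) = b at *
  have hab : a < b := by nlinarith
  have hsq : x ^ 2 = 1 + (b + 2 * a) * x := by
    rw [hpow]
    linear_combination b ^ 2 * phi_sq + hcassini
  rw [hL, arctan_inv_eq_add_of_cassini ha hab hcassini, arctan_one]
  linear_combination (1 / 2) * two_mul_arctan_of_sq_eq hx hsq
end

section
/- For every positive integer k, arctan(φ^(2k-1)) = 2·arctan(1) − (1/2)·arctan(1 / L_{2k}) − (1/2)·arctan(1 / F_{2k}). -/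
open Real Finset

theorem one_le_lucas (n : ℕ) : 1 ≤ lucas n := by
  induction n using Nat.twoStepInduction with
  | zero => simp [lucas]
  | one => simp [lucas]
  | more n ih₀ ih₁ => rw [lucas]; omega

theorem one_lt_lucas_add_two (n : ℕ) : 1 < lucas (n + 2) := by
  have h₀ := one_le_lucas n
  have h₁ := one_le_lucas (n + 1)
  rw [lucas]
  omega

theorem goldenRatio_pow_mul_goldenConj_pow_odd (j : ℕ) :
    goldenRatio ^ (2 * j + 1) * goldenConj ^ (2 * j + 1) = -1 := by
  rw [← mul_pow, goldenRatio_mul_goldenConj, Odd.neg_one_pow ⟨j, rfl⟩]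

/-- With `m = 2 * j + 1`, this is `2 * (L (m + 1) * F (m + 1) - 1) = (L (m + 1) + F (m + 1)) * L m`,
where `L m` is written out by Binet's formula. -/
theorem two_mul_lucas_mul_fib_sub_one (j : ℕ) :
    2 * ((lucas (2 * j + 2) : ℝ) * (Nat.fib (2 * j + 2) : ℝ) - 1) =
      ((lucas (2 * j + 2) : ℝ) + Nat.fib (2 * j + 2)) *
        (goldenRatio ^ (2 * j + 1) + goldenConj ^ (2 * j + 1)) := by
  have hpq := goldenRatio_pow_mul_goldenConj_pow_odd j
  have hs : (√5 : ℝ) ^ 2 = 5 := Real.sq_sqrt (by norm_num)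
  have hs0 : (√5 : ℝ) ≠ 0 := by positivity
  rw [coe_lucas_eq, coe_fib_eq, pow_succ goldenRatio (2 * j + 1), pow_succ goldenConj (2 * j + 1)]
  generalize goldenRatio ^ (2 * j + 1) = p at *
  generalize goldenConj ^ (2 * j + 1) = q at *
  have hφ : goldenRatio = (1 + √5) / 2 := rfl
  have hψ : goldenConj = (1 - √5) / 2 := rfl
  rw [hφ, hψ]
  generalize √5 = s at *
  field_simp
  ring_nf
  simp only [hs]
  linear_combination (-4 * s) * hpq

theorem two_mul_arctan_inv_goldenRatio_pow_odd (j : ℕ) :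
    2 * arctan (goldenRatio ^ (2 * j + 1))⁻¹ =
      arctan (1 / (lucas (2 * j + 2) : ℝ)) + arctan (1 / (Nat.fib (2 * j + 2) : ℝ)) := by
  have hid := two_mul_lucas_mul_fib_sub_one j
  have hpq := goldenRatio_pow_mul_goldenConj_pow_odd j
  have hp : 1 < goldenRatio ^ (2 * j + 1) := one_lt_pow₀ one_lt_goldenRatio (by omega)
  have hL : (1 : ℝ) < lucas (2 * j + 2) := by exact_mod_cast one_lt_lucas_add_two (2 * j)
  have hF : (1 : ℝ) ≤ Nat.fib (2 * j + 2) := by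
    exact_mod_cast Nat.fib_pos.2 (by omega : 0 < 2 * j + 2)
  generalize goldenRatio ^ (2 * j + 1) = p at *
  generalize goldenConj ^ (2 * j + 1) = q at *
  generalize (lucas (2 * j + 2) : ℝ) = L at *
  generalize (Nat.fib (2 * j + 2) : ℝ) = F at *
  have hLF : 1 < L * F := by nlinarith
  have hp0 : 0 < p := by linarith
  have hp1 : p⁻¹ < 1 := inv_lt_one_of_one_lt₀ hp
  have hpi : 0 < p⁻¹ := inv_pos.2 hp0
  rw [two_mul_arctan (by linarith) hp1, arctan_add]
  · congr 1
    have hLF' : L * F - 1 ≠ 0 := by linarith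
    have hp2 : p ^ 2 - 1 ≠ 0 := by nlinarith
    have hleft : 2 * p⁻¹ / (1 - p⁻¹ ^ 2) = 2 * p / (p ^ 2 - 1) := by
      field_simp
    have hright : (1 / L + 1 / F) / (1 - 1 / L * (1 / F)) = (L + F) / (L * F - 1) := by
      have : L ≠ 0 := by linarith
      have : F ≠ 0 := by linarith
      field_simp
      ring
    rw [hleft, hright, div_eq_div_iff hp2 hLF']
    linear_combination p * hid + (L + F) * hpq
  · rw [div_mul_div_comm, one_mul, div_lt_one (by linarith)]
    exact hLF

theorem stmt2 (k : ℕ) (hk : 1 ≤ k) :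
    Real.arctan (phi ^ (2 * k - 1)) =
      2 * Real.arctan 1 - (1 / 2) * Real.arctan (1 / (lucas (2 * k) : ℝ))
        - (1 / 2) * Real.arctan (1 / (Nat.fib (2 * k) : ℝ)) := by
  obtain ⟨j, rfl⟩ := Nat.exists_eq_add_of_le' hk
  have h := two_mul_arctan_inv_goldenRatio_pow_odd j
  rw [arctan_inv_of_pos (pow_pos goldenRatio_pos _)] at h
  rw [phi_eq_goldenRatio, arctan_one, show 2 * (j + 1) - 1 = 2 * j + 1 by omega,
    show 2 * (j + 1) = 2 * j + 2 by ring]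
  linarith
end

section
/- For every positive integer k, arctan(φ^(2k+1)) + arctan(φ^(2k-1)) = π − arctan(1 / F_{2k}). -/
open Real Finset

/-- The arctangents of `P φ` and `P / φ = -P ψ` add up past `π / 2`. -/
theorem arctan_mul_goldenRatio_add_arctan_neg_mul_goldenConj {P : ℝ} (hP : 1 < P) :
    arctan (P * goldenRatio) + arctan (-(P * goldenConj)) =
      π - arctan (√5 / (P - P⁻¹)) := by
  have hprod : P * goldenRatio * -(P * goldenConj) = P ^ 2 := by
    linear_combination -P ^ 2 * goldenRatio_mul_goldenConj
  have hsum : P * goldenRatio + -(P * goldenConj) = P * √5 := by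
    linear_combination P * goldenRatio_sub_goldenConj
  have hsq : 1 < P ^ 2 := by nlinarith
  have hdiv : P * √5 / (1 - P ^ 2) = -(√5 / (P - P⁻¹)) := by
    have h₁ : 1 - P ^ 2 ≠ 0 := by linarith
    have h₂ : P ≠ 0 := by linarith
    have h₃ : P - P⁻¹ ≠ 0 := by
      have := inv_lt_one_of_one_lt₀ hP
      linarith
    rw [← neg_div, div_eq_div_iff h₁ h₃]
    field_simp
    ring
  rw [arctan_add_eq_add_pi (by rwa [hprod]) (mul_pos (by linarith) goldenRatio_pos),
    hprod, hsum, hdiv, arctan_neg]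
  ring

theorem stmt3 (k : ℕ) (hk : 1 ≤ k) :
    Real.arctan (phi ^ (2 * k + 1)) + Real.arctan (phi ^ (2 * k - 1)) =
      Real.pi - Real.arctan (1 / (Nat.fib (2 * k) : ℝ)) := by
  have hφ : phi = goldenRatio := rfl
  have hinv : (goldenRatio ^ (2 * k))⁻¹ = goldenConj ^ (2 * k) := by
    rw [← inv_pow, inv_goldenRatio, (even_two_mul k).neg_pow]
  have hpred : goldenRatio ^ (2 * k - 1) = -(goldenRatio ^ (2 * k) * goldenConj) := by
    obtain ⟨n, hn⟩ : ∃ n, 2 * k = n + 1 := ⟨2 * k - 1, by omega⟩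
    rw [hn, Nat.add_sub_cancel, pow_succ]
    linear_combination goldenRatio ^ n * goldenRatio_mul_goldenConj
  rw [hφ, hpred, pow_succ, arctan_mul_goldenRatio_add_arctan_neg_mul_goldenConj
    (one_lt_pow₀ one_lt_goldenRatio (by omega)), hinv, coe_fib_eq, one_div_div]
end

section
/- For every positive integer k, arctan(φ^(2k+1)) − arctan(φ^(2k-1)) = arctan(1 / L_{2k}). -/
open Real Finset

theorem lucas_eq_goldenRatio_pow_add_goldenConj_pow :
    ∀ n : ℕ, (lucas n : ℝ) = goldenRatio ^ n + goldenConj ^ n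
  | 0 => by norm_num [lucas]
  | 1 => by simp [lucas]
  | n + 2 => by
    rw [lucas, Nat.cast_add, lucas_eq_goldenRatio_pow_add_goldenConj_pow (n + 1),
      lucas_eq_goldenRatio_pow_add_goldenConj_pow n]
    linear_combination -goldenRatio ^ n * goldenRatio_sq - goldenConj ^ n * goldenConj_sq

theorem arctan_sub_arctan_of_mul_nonneg {x y : ℝ} (h : 0 ≤ x * y) :
    arctan x - arctan y = arctan ((x - y) / (1 + x * y)) := by
  rw [sub_eq_add_neg, ← arctan_neg, arctan_add (by linarith)]
  congr 2
  ring

theorem stmt4 (k : ℕ) (hk : 1 ≤ k) :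
    Real.arctan (phi ^ (2 * k + 1)) - Real.arctan (phi ^ (2 * k - 1)) =
      Real.arctan (1 / (lucas (2 * k) : ℝ)) := by
  have hphi : phi = goldenRatio := rfl
  have hpos := goldenRatio_pos
  obtain ⟨m, rfl⟩ : ∃ m, k = m + 1 := ⟨k - 1, by omega⟩
  rw [hphi, arctan_sub_arctan_of_mul_nonneg (by positivity),
    lucas_eq_goldenRatio_pow_add_goldenConj_pow, show 2 * (m + 1) - 1 = 2 * m + 1 by omega]
  have hPQ : goldenRatio ^ (2 * (m + 1)) * goldenConj ^ (2 * (m + 1)) = 1 := by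
    rw [← mul_pow, goldenRatio_mul_goldenConj, pow_mul]
    norm_num
  have hdiff : goldenRatio ^ (2 * (m + 1) + 1) - goldenRatio ^ (2 * m + 1) =
      goldenRatio ^ (2 * (m + 1)) := by
    linear_combination goldenRatio ^ (2 * m + 1) * goldenRatio_sq
  have hprod : goldenRatio ^ (2 * (m + 1) + 1) * goldenRatio ^ (2 * m + 1) =
      goldenRatio ^ (2 * (m + 1)) * goldenRatio ^ (2 * (m + 1)) := by
    ring
  have hden : 1 + goldenRatio ^ (2 * (m + 1)) * goldenRatio ^ (2 * (m + 1)) =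
      goldenRatio ^ (2 * (m + 1)) * (goldenRatio ^ (2 * (m + 1)) + goldenConj ^ (2 * (m + 1))) := by
    linear_combination -hPQ
  rw [hdiff, hprod, hden, div_mul_cancel_left₀ (by positivity), one_div]
end

section
/- arctan(φ) = arctan(1) + (1/2)·arctan(1/2). -/
open Real Finset

theorem stmt6 :
    Real.arctan phi = Real.arctan 1 + (1 / 2) * Real.arctan (1 / 2) := by
  have double := two_mul_arctan_add_pi one_lt_goldenRatio
  have arg : 2 * goldenRatio / (1 - goldenRatio ^ 2) = -2 := by
    rw [goldenRatio_sq, sub_add_cancel_right, div_neg,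
      mul_div_cancel_right₀ _ goldenRatio_ne_zero]
  have half := arctan_inv_of_pos (zero_lt_two (α := ℝ))
  rw [arg, arctan_neg] at double
  rw [show phi = goldenRatio from rfl, arctan_one, one_div (2 : ℝ), half]
  linarith
end

section
/- For every positive integer k, 2·arctan(1 / φ^(2k)) = arctan(2 / (F_{2k}·√5)). -/
open Real Finset

theorem fib_two_mul_mul_sqrt_five (k : ℕ) :
    (Nat.fib (2 * k) : ℝ) * Real.sqrt 5 = phi ^ (2 * k) - (phi ^ (2 * k))⁻¹ := by
  have hphi : phi = Real.goldenRatio := rfl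
  have h5 : Real.sqrt 5 ≠ 0 := by positivity
  rw [Real.coe_fib_eq, div_mul_cancel₀ _ h5, hphi, ← inv_pow, Real.inv_goldenRatio,
    Even.neg_pow (even_two_mul k)]

theorem stmt9 (k : ℕ) (hk : 1 ≤ k) :
    2 * Real.arctan (1 / phi ^ (2 * k)) =
      Real.arctan (2 / ((Nat.fib (2 * k) : ℝ) * Real.sqrt 5)) := by
  have hx : 1 < phi ^ (2 * k) := one_lt_pow₀ Real.one_lt_goldenRatio (by omega)
  rw [fib_two_mul_mul_sqrt_five]
  generalize phi ^ (2 * k) = x at hx ⊢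
  have hx0 : 0 < x := by linarith
  have hinv : 1 / x < 1 := (div_lt_one hx0).2 hx
  have hpos : 0 < 1 / x := by positivity
  have hsq : x ^ 2 - 1 ≠ 0 := by nlinarith
  rw [Real.two_mul_arctan (by linarith) hinv]
  congr 1
  have h₁ : 1 - (1 / x) ^ 2 = (x ^ 2 - 1) / x ^ 2 := by field_simp
  have h₂ : x - x⁻¹ = (x ^ 2 - 1) / x := by field_simp
  rw [h₁, h₂]
  field_simp
end

section
/- For every non-negative integer k, 2·arctan(1 / φ^(2k+2)) = arctan(√5 / L_{2k+1}) − arctan(1 / (F_{2k+1}·√5)). -/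
open Real Finset

theorem goldenConj_pow_two_mul_add_one (k : ℕ) :
    goldenConj ^ (2 * k + 1) = -(1 / goldenRatio ^ (2 * k + 1)) := by
  have h : goldenConj = -goldenRatio⁻¹ := by rw [inv_goldenRatio, neg_neg]
  rw [h, Odd.neg_pow ⟨k, rfl⟩, inv_pow, one_div]

theorem two_mul_arctan_one_div_mul_goldenRatio {a : ℝ} (ha : 1 < a) :
    2 * arctan (1 / (a * goldenRatio)) =
      arctan (√5 / (a - 1 / a)) - arctan (1 / (a + 1 / a)) := by
  have hφ := one_lt_goldenRatio
  have hsq := goldenRatio_sq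
  have h5 : √5 = 2 * goldenRatio - 1 := by rw [goldenRatio]; ring
  generalize goldenRatio = p at *
  have ha0 : 0 < a := by linarith
  have hp0 : 0 < p := by linarith
  have hap : 1 < a * p := by nlinarith
  have hx : 0 < 1 / (a * p) := by positivity
  have hx1 : 1 / (a * p) < 1 := by rw [div_lt_one (by positivity)]; exact hap
  have ha2 : 0 < a ^ 2 - 1 := by nlinarith
  have hL : a - 1 / a = (a ^ 2 - 1) / a := by field_simp
  have hF : a + 1 / a = (a ^ 2 + 1) / a := by field_simp
  have hy : 0 < √5 / (a - 1 / a) := by rw [hL]; positivity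
  have hz : 0 < 1 / (a + 1 / a) := by positivity
  rw [two_mul_arctan (by linarith) hx1, sub_eq_add_neg (arctan _), ← arctan_neg,
    arctan_add (by nlinarith [mul_pos hy hz])]
  congr 1
  have hap2 : 0 < (a * p) ^ 2 - 1 := by nlinarith
  have hq : 0 < 2 * p - 1 := by linarith
  have hD : 0 < (a ^ 2 - 1) * (a ^ 2 + 1) + (2 * p - 1) * a ^ 2 := by positivity
  have e1 : 2 * (1 / (a * p)) / (1 - (1 / (a * p)) ^ 2) = 2 * (a * p) / ((a * p) ^ 2 - 1) := by
    have : 1 - (1 / (a * p)) ^ 2 = ((a * p) ^ 2 - 1) / (a * p) ^ 2 := by field_simp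
    rw [this]
    field_simp
  have e2 : (√5 / (a - 1 / a) + -(1 / (a + 1 / a))) / (1 - √5 / (a - 1 / a) * -(1 / (a + 1 / a)))
      = a * ((2 * p - 1) * (a ^ 2 + 1) - (a ^ 2 - 1)) /
        ((a ^ 2 - 1) * (a ^ 2 + 1) + (2 * p - 1) * a ^ 2) := by
    have hden : 1 - √5 / (a - 1 / a) * -(1 / (a + 1 / a)) =
        ((a ^ 2 - 1) * (a ^ 2 + 1) + (2 * p - 1) * a ^ 2) / ((a ^ 2 - 1) * (a ^ 2 + 1)) := by
      rw [hL, hF, h5]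
      field_simp
      ring
    rw [hden, hL, hF, h5]
    field_simp
    ring
  rw [e1, e2, div_eq_div_iff hap2.ne' hD.ne']
  have hp3 : p ^ 3 = 2 * p + 1 := by linear_combination (p + 1) * hsq
  ring_nf
  simp only [hp3, hsq]
  ring

theorem stmt11 (k : ℕ) :
    2 * Real.arctan (1 / phi ^ (2 * k + 2)) =
      Real.arctan (Real.sqrt 5 / (lucas (2 * k + 1) : ℝ))
        - Real.arctan (1 / ((Nat.fib (2 * k + 1) : ℝ) * Real.sqrt 5)) := by
  have hL : (lucas (2 * k + 1) : ℝ) =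
      goldenRatio ^ (2 * k + 1) - 1 / goldenRatio ^ (2 * k + 1) := by
    rw [coe_lucas_eq, goldenConj_pow_two_mul_add_one, sub_eq_add_neg]
  have hF : (Nat.fib (2 * k + 1) : ℝ) * √5 =
      goldenRatio ^ (2 * k + 1) + 1 / goldenRatio ^ (2 * k + 1) := by
    rw [coe_fib_eq, div_mul_cancel₀ _ (by positivity), goldenConj_pow_two_mul_add_one,
      sub_neg_eq_add]
  rw [hL, hF, phi_eq_goldenRatio, pow_succ goldenRatio (2 * k + 1)]
  exact two_mul_arctan_one_div_mul_goldenRatio (one_lt_pow₀ one_lt_goldenRatio (by omega))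
end

section
/- For every integer n ≥ 2, arctan(1 / F_{2n-2}) = arctan(1 / F_{2n}) + arctan(1 / L_{2n-2}) + arctan(1 / L_{2n}). -/
open Real Finset

theorem fib_two_mul_cassini (k : ℕ) :
    (Nat.fib (2 * k + 1) : ℝ) ^ 2 =
      1 + Nat.fib (2 * k) * Nat.fib (2 * k + 1) + (Nat.fib (2 * k) : ℝ) ^ 2 := by
  induction k with
  | zero => simp
  | succ k ih =>
    rw [show 2 * (k + 1) = 2 * k + 2 by ring, Nat.fib_add_two (n := 2 * k + 1),
      Nat.fib_add_two (n := 2 * k)]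
    push_cast
    linear_combination ih

theorem arctan_one_div_eq_add_add {a b c : ℝ} (ha : 1 ≤ a) (hab : a ≤ b)
    (hc : c + a = 2 * b) (h : b ^ 2 = 1 + a * b + a ^ 2) :
    arctan (1 / a) =
      arctan (1 / (a + b)) + arctan (1 / c) + arctan (1 / (a + 3 * b)) := by
  have ha₀ : 0 < a := by linarith
  have hb₀ : 0 < b := by linarith
  have h₁ : 0 < a + b := by linarith
  have h₂ : 0 < c := by linarith
  have h₃ : 0 < a + 3 * b := by linarith
  have h₄ : 0 < b + 2 * a := by linarith
  have d₁ : 1 - 1 / (a + b) * (1 / c) =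
      b * (b + 2 * a) / ((a + b) * c) := by
    field_simp
    linear_combination (a + b) * hc + h
  have d₂ : 1 - 3 / (b + 2 * a) * (1 / (a + 3 * b)) =
      5 * a * (a + 2 * b) / ((b + 2 * a) * (a + 3 * b)) := by
    field_simp
    linear_combination 3 * h
  have p₁ : 0 < 1 - 1 / (a + b) * (1 / c) := by rw [d₁]; positivity
  have p₂ : 0 < 1 - 3 / (b + 2 * a) * (1 / (a + 3 * b)) := by rw [d₂]; positivity
  have e₁ : (1 / (a + b) + 1 / c) / (1 - 1 / (a + b) * (1 / c)) =
      3 / (b + 2 * a) := by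
    rw [d₁]
    field_simp
    linear_combination hc
  have e₂ : (3 / (b + 2 * a) + 1 / (a + 3 * b)) / (1 - 3 / (b + 2 * a) * (1 / (a + 3 * b))) =
      1 / a := by
    rw [d₂]
    field_simp
    ring
  rw [arctan_add (by linarith), e₁, arctan_add (by linarith), e₂]

theorem stmt13 (n : ℕ) (hn : 2 ≤ n) :
    Real.arctan (1 / (Nat.fib (2 * n - 2) : ℝ)) =
      Real.arctan (1 / (Nat.fib (2 * n) : ℝ))
        + Real.arctan (1 / (lucas (2 * n - 2) : ℝ))
        + Real.arctan (1 / (lucas (2 * n) : ℝ)) := by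
  obtain ⟨k, rfl⟩ : ∃ k, n = k + 1 := ⟨n - 1, by lia⟩
  have hk : 0 < 2 * k := by lia
  rw [show 2 * (k + 1) - 2 = 2 * k by lia, show 2 * (k + 1) = 2 * k + 2 by ring]
  have hL₂ : (lucas (2 * k + 2) : ℝ) = Nat.fib (2 * k) + 3 * Nat.fib (2 * k + 1) := by
    have h := lucas_add_fib (2 * k + 2)
    rw [Nat.fib_add_two (n := 2 * k + 1), Nat.fib_add_two (n := 2 * k)] at h
    exact_mod_cast (by lia :
      lucas (2 * k + 2) = Nat.fib (2 * k) + 3 * Nat.fib (2 * k + 1))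
  rw [hL₂, Nat.fib_add_two, Nat.cast_add]
  exact arctan_one_div_eq_add_add (mod_cast Nat.fib_pos.mpr hk)
    (mod_cast Nat.fib_le_fib_succ)
    (mod_cast lucas_add_fib (2 * k)) (fib_two_mul_cassini k)
end

section
/- For every positive integer n, arctan(2 / (F_{2n}·√5)) = arctan(√5 / L_{2n+1}) + arctan(1 / (F_{2n+1}·√5)). -/
open Real Finset

theorem lucas_succ_eq (n : ℕ) :
    lucas (n + 1) = 2 * Nat.fib n + Nat.fib (n + 1) := by
  induction n using Nat.twoStepInduction with
  | zero => simp [lucas]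
  | one => simp [lucas]
  | more n ih₁ ih₂ =>
    have h₁ := Nat.fib_add_two (n := n)
    have h₂ := Nat.fib_add_two (n := n + 1)
    have h₃ : lucas (n + 2 + 1) = lucas (n + 1 + 1) + lucas (n + 1) := rfl
    grind

theorem fib_two_mul_succ_sq (n : ℕ) :
    Nat.fib (2 * n + 1) ^ 2 =
      Nat.fib (2 * n) * Nat.fib (2 * n + 1) + Nat.fib (2 * n) ^ 2 + 1 := by
  induction n with
  | zero => simp
  | succ n ih =>
    have h₁ := Nat.fib_add_two (n := 2 * n)
    have h₂ := Nat.fib_add_two (n := 2 * n + 1)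
    rw [show 2 * (n + 1) = 2 * n + 2 by ring, h₂, h₁]
    linarith

theorem stmt16 (n : ℕ) (hn : 1 ≤ n) :
    Real.arctan (2 / ((Nat.fib (2 * n) : ℝ) * Real.sqrt 5)) =
      Real.arctan (Real.sqrt 5 / (lucas (2 * n + 1) : ℝ))
        + Real.arctan (1 / ((Nat.fib (2 * n + 1) : ℝ) * Real.sqrt 5)) := by
  have ha : (0 : ℝ) < Nat.fib (2 * n) := by
    exact_mod_cast Nat.fib_pos.mpr (by omega)
  have hb : (1 : ℝ) ≤ Nat.fib (2 * n + 1) := by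
    exact_mod_cast Nat.fib_pos.mpr (by omega)
  have hl : (lucas (2 * n + 1) : ℝ) = 2 * Nat.fib (2 * n) + Nat.fib (2 * n + 1) := by
    exact_mod_cast lucas_succ_eq (2 * n)
  have hc : (Nat.fib (2 * n + 1) : ℝ) ^ 2 =
      Nat.fib (2 * n) * Nat.fib (2 * n + 1) + Nat.fib (2 * n) ^ 2 + 1 := by
    exact_mod_cast fib_two_mul_succ_sq n
  rw [hl]
  generalize (Nat.fib (2 * n) : ℝ) = a at *
  generalize (Nat.fib (2 * n + 1) : ℝ) = b at *
  have hs : (0 : ℝ) < √5 := by positivity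
  have hs2 : √5 ^ 2 = (5 : ℝ) := Real.sq_sqrt (by norm_num)
  have hb0 : 0 < b := by linarith
  have hd : 0 < (2 * a + b) * b - 1 := by nlinarith
  have hxy : √5 / (2 * a + b) * (1 / (b * √5)) = 1 / ((2 * a + b) * b) := by
    field_simp
  have hx : √5 / (2 * a + b) + 1 / (b * √5) =
      (5 * b + (2 * a + b)) / ((2 * a + b) * b * √5) := by
    field_simp
    rw [hs2]
    ring
  have hy : 1 - 1 / ((2 * a + b) * b) = ((2 * a + b) * b - 1) / ((2 * a + b) * b) := by
    field_simp
  rw [Real.arctan_add, hxy, hx, hy]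
  · congr 1
    rw [div_div_div_eq, div_eq_div_iff (by positivity) (by positivity)]
    linear_combination 2 * (2 * a + b) * b * √5 * hc
  · rw [hxy, div_lt_one (by positivity)]
    linarith
end

section
/- For every positive integer n, arctan(2 / L_{2n-1}) = 2·arctan(1 / L_{2n}) + arctan(2 / L_{2n+1}). -/
open Real Finset

theorem lucas_two_mul_add_two_sq (m : ℕ) :
    lucas (2 * m + 2) ^ 2 = lucas (2 * m + 1) * lucas (2 * m + 3) + 5 := by
  induction m with
  | zero => simp [lucas]
  | succ k ih =>
    simp only [show 2 * (k + 1) = 2 * k + 2 by ring, lucas] at ih ⊢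
    nlinarith

theorem lucas_pos (m : ℕ) : 0 < lucas m := by
  induction m using Nat.twoStepInduction with
  | zero => simp [lucas]
  | one => simp [lucas]
  | more k ih _ => simp only [lucas]; lia

theorem arctan_two_div_eq_of_sq_eq {a b : ℝ} (ha : 0 < a) (hb : 0 < b)
    (h : b ^ 2 = a * (a + b) + 5) :
    arctan (2 / a) = 2 * arctan (1 / b) + arctan (2 / (a + b)) := by
  have hb2 : 2 < b := by nlinarith [mul_pos ha hb]
  have hb1 : 0 < b ^ 2 - 1 := by nlinarith
  have hdouble : 2 * (1 / b) / (1 - (1 / b) ^ 2) = 2 * b / (b ^ 2 - 1) := by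
    have h1 : 1 - (1 / b) ^ 2 = (b ^ 2 - 1) / b ^ 2 := by field_simp
    rw [h1]
    field_simp
  have hlt : 2 * b / (b ^ 2 - 1) * (2 / (a + b)) < 1 := by
    rw [div_mul_div_comm, div_lt_one (by positivity)]
    nlinarith [mul_pos hb1 ha, mul_pos hb (sub_pos.2 hb2)]
  rw [two_mul_arctan (by linarith [one_div_pos.2 hb]) (by rw [div_lt_one hb]; linarith),
    hdouble, arctan_add hlt]
  congr 1
  have hden : 0 < (b ^ 2 - 1) * (a + b) - 4 * b := by
    rw [div_mul_div_comm, div_lt_one (by positivity)] at hlt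
    linarith
  have hsum : (2 * b / (b ^ 2 - 1) + 2 / (a + b)) / (1 - 2 * b / (b ^ 2 - 1) * (2 / (a + b))) =
      (2 * b * (a + b) + 2 * (b ^ 2 - 1)) / ((b ^ 2 - 1) * (a + b) - 4 * b) := by
    have hsub : 1 - 2 * b / (b ^ 2 - 1) * (2 / (a + b)) =
        ((b ^ 2 - 1) * (a + b) - 4 * b) / ((b ^ 2 - 1) * (a + b)) := by
      field_simp
      ring
    rw [hsub, div_add_div _ _ hb1.ne' (by positivity), div_div_div_cancel_right₀ (by positivity)]
    ring
  rw [hsum, div_eq_div_iff ha.ne' hden.ne']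
  linear_combination 2 * b * h

theorem stmt17 (n : ℕ) (hn : 1 ≤ n) :
    Real.arctan (2 / (lucas (2 * n - 1) : ℝ)) =
      2 * Real.arctan (1 / (lucas (2 * n) : ℝ))
        + Real.arctan (2 / (lucas (2 * n + 1) : ℝ)) := by
  obtain ⟨m, rfl⟩ : ∃ m, n = m + 1 := ⟨n - 1, by lia⟩
  have hrec : (lucas (2 * (m + 1) + 1) : ℝ) = lucas (2 * m + 1) + lucas (2 * m + 2) := by
    exact_mod_cast Nat.add_comm (lucas (2 * m + 2)) (lucas (2 * m + 1))
  have hsq : (lucas (2 * m + 2) : ℝ) ^ 2 =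
      lucas (2 * m + 1) * (lucas (2 * m + 1) + lucas (2 * m + 2)) + 5 := by
    rw [← hrec]
    exact_mod_cast lucas_two_mul_add_two_sq m
  rw [hrec]
  exact arctan_two_div_eq_of_sq_eq (mod_cast lucas_pos _) (mod_cast lucas_pos _) hsq
end

section
/- The series Σ_{k=1}^{∞} arctan(1 / L_{2k}) converges and its sum equals arctan(1 / φ). -/
open Real Finset

theorem phi_pos : 0 < phi := by
  unfold phi; positivity

theorem phi_inv : phi⁻¹ = phi - 1 :=
  inv_eq_of_mul_eq_one_right (by linear_combination phi_sq)

/-- Binet's formula for the Lucas numbers. -/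
theorem lucas_eq_pow_add_pow : ∀ n : ℕ, (lucas n : ℝ) = phi ^ n + (-phi⁻¹) ^ n
  | 0 => by norm_num [lucas]
  | 1 => by rw [phi_inv]; norm_num [lucas]
  | n + 2 => by
    rw [lucas, Nat.cast_add, lucas_eq_pow_add_pow (n + 1), lucas_eq_pow_add_pow n, phi_inv]
    linear_combination (-phi ^ n - (-(phi - 1)) ^ n) * phi_sq

theorem arctan_one_div_lucas_even (n : ℕ) :
    Real.arctan (1 / (lucas (2 * (n + 1)) : ℝ)) =
      Real.arctan (phi⁻¹ ^ (2 * n + 1)) - Real.arctan (phi⁻¹ ^ (2 * (n + 1) + 1)) := by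
  have hpos := inv_pos.2 phi_pos
  rw [sub_eq_add_neg, ← Real.arctan_neg, Real.arctan_add]
  · congr 1
    rw [lucas_eq_pow_add_pow, (even_two_mul _).neg_pow]
    have hphi := phi_pos
    have hq : phi * phi⁻¹ = 1 := mul_inv_cancel₀ hphi.ne'
    have hsq : phi⁻¹ ^ 2 = 1 - phi⁻¹ := by
      linear_combination phi⁻¹ * phi_inv + hq
    have hpow : phi ^ (2 * (n + 1)) * phi⁻¹ ^ (2 * (n + 1)) = 1 := by
      rw [← mul_pow, hq, one_pow]
    rw [div_eq_div_iff (by positivity)]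
    · generalize phi ^ (2 * (n + 1)) = P at *
      have e : phi⁻¹ ^ (2 * (n + 1)) = phi⁻¹ ^ (2 * n + 1) * phi⁻¹ := by ring
      have e' : phi⁻¹ ^ (2 * (n + 1) + 1) = phi⁻¹ ^ (2 * n + 1) * phi⁻¹ ^ 2 := by ring
      rw [e] at hpow
      rw [e, e', hsq]
      generalize phi⁻¹ ^ (2 * n + 1) = a at *
      generalize phi⁻¹ = q at *
      linear_combination a ^ 2 * (-hsq) - hpow
    · rw [mul_neg, sub_neg_eq_add]; positivity
  · have : 0 < phi⁻¹ ^ (2 * n + 1) * phi⁻¹ ^ (2 * (n + 1) + 1) := by positivity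
    linarith

theorem stmt19 :
    HasSum (fun k : ℕ => Real.arctan (1 / (lucas (2 * (k + 1)) : ℝ)))
      (Real.arctan (1 / phi)) := by
  rw [hasSum_iff_tendsto_nat_of_nonneg fun k => Real.arctan_nonneg.2 (by positivity)]
  simp_rw [arctan_one_div_lucas_even]
  simp_rw [Finset.sum_range_sub' fun n => Real.arctan (phi⁻¹ ^ (2 * n + 1))]
  have hlt : phi⁻¹ < 1 := by
    nlinarith [phi_inv, phi_sq, phi_pos]
  have hexp : Filter.Tendsto (fun n : ℕ => 2 * n + 1) Filter.atTop Filter.atTop :=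
    Filter.tendsto_atTop_mono (fun n => show n ≤ 2 * n + 1 by omega) Filter.tendsto_id
  have hlim := (Real.continuous_arctan.tendsto 0).comp
    ((tendsto_pow_atTop_nhds_zero_of_lt_one (inv_pos.2 phi_pos).le hlt).comp hexp)
  simpa [Function.comp_def] using hlim.const_sub (Real.arctan phi⁻¹)
end
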